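/- arXiv:2210.14787 — 3 statements merged into one kernel-verified Lean document; each statement's English description precedes it below -/
import Mathlib

section
/- Let k be a field of characteristic zero, A = k[X₀,X₁,X₂] the polynomial ring in three variables over k, I ⊆ A an ideal, R = A/I, and π : A → R the quotient map. Suppose τ̃ is a k-derivation of A with τ̃(I) ⊆ I, and let τ be the induced k-derivation of R (i.e. τ(π(a)) = π(τ̃(a)) for all a ∈ A). Assume that the map R → Der_k(R), r ↦ r·τ, is bijective, and that Der_k(R) is a simple Lie algebra over k. Then every D ∈ Der_k(R) can be written as a sum of three Lie brackets: there exist D₁, D₂, D₃, D₄, D₅, D₆ ∈ Der_k(R) with D = ⁅D₁,D₂⁆ + ⁅D₃,D₄⁆ + ⁅D₅,D₆⁆. -/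
set_option synthInstance.maxHeartbeats 1000000
set_option maxHeartbeats 2000000

open Finset in
/-- The Leibniz rule for iterates of a derivation. -/
theorem Derivation.iterate_apply_mul {k R : Type*} [CommRing k] [CommRing R] [Algebra k R]
    (τ : Derivation k R R) (n : ℕ) (a b : R) :
    τ^[n] (a * b) =
      ∑ ij ∈ antidiagonal n, (n.choose ij.1 : R) * (τ^[ij.1] a * τ^[ij.2] b) := by
  induction n with
  | zero => simp
  | succ n ih =>
    rw [sum_antidiagonal_choose_succ_mul (fun i j => τ^[i] a * τ^[j] b), Function.iterate_succ_apply',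
      ih, map_sum, ← sum_add_distrib]
    refine sum_congr rfl fun ij hij => ?_
    rw [← Nat.choose_symm_of_eq_add (mem_antidiagonal.mp hij).symm, Function.iterate_succ_apply',
      Function.iterate_succ_apply', Derivation.leibniz, Derivation.leibniz, Derivation.map_natCast]
    simp only [smul_eq_mul]
    ring

/-- The largest ideal stable under a derivation and contained in a given ideal. -/
def Derivation.stableCore {k R : Type*} [CommRing k] [CommRing R] [Algebra k R]
    (τ : Derivation k R R) (p : Ideal R) : Ideal R where
  carrier := {r | ∀ n, τ^[n] r ∈ p}
  add_mem' ha hb n := by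
    rw [iterate_map_add]
    exact p.add_mem (ha n) (hb n)
  zero_mem' n := by
    rw [iterate_map_zero]
    exact p.zero_mem
  smul_mem' c r hr n := by
    rw [smul_eq_mul, Derivation.iterate_apply_mul]
    exact p.sum_mem fun ij _ => p.mul_mem_left _ (p.mul_mem_left _ (hr _))

open Finset in
theorem Derivation.stableCore_isPrime {k R : Type*} [Field k] [CharZero k] [CommRing R]
    [Algebra k R] (τ : Derivation k R R) (p : Ideal R) [hp : p.IsPrime] :
    (τ.stableCore p).IsPrime := by
  classical
  refine Ideal.isPrime_iff.mpr ⟨fun h => hp.ne_top ?_, fun {a b} hab => ?_⟩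
  · exact (Ideal.eq_top_iff_one p).mpr ((Ideal.eq_top_iff_one _).mp h 0)
  · by_contra! hcon
    have ha : ∃ n, τ^[n] a ∉ p := not_forall.mp hcon.1
    have hb : ∃ n, τ^[n] b ∉ p := not_forall.mp hcon.2
    set i := Nat.find ha
    set j := Nat.find hb
    have hmem := hab (i + j)
    rw [Derivation.iterate_apply_mul,
      ← add_sum_erase _ _ (HasAntidiagonal.mem_antidiagonal.mpr rfl : (i, j) ∈ antidiagonal (i + j))]
      at hmem
    have hrest : ∑ x ∈ (antidiagonal (i + j)).erase (i, j),
        ((i + j).choose x.1 : R) * (τ^[x.1] a * τ^[x.2] b) ∈ p := by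
      refine p.sum_mem fun x hx => p.mul_mem_left _ ?_
      rw [mem_erase, HasAntidiagonal.mem_antidiagonal, Ne, Prod.ext_iff] at hx
      obtain h | h : x.1 < i ∨ x.2 < j := by
        have := hx.1
        have := hx.2
        dsimp only at *
        omega
      · exact p.mul_mem_right _ (not_not.mp (Nat.find_min ha h))
      · exact p.mul_mem_left _ (not_not.mp (Nat.find_min hb h))
    have hmain := (p.add_mem_iff_left hrest).mp hmem
    have hunit : IsUnit ((i + j).choose i : R) := by
      rw [← _root_.map_natCast (algebraMap k R)]
      exact (Nat.cast_ne_zero.mpr (Nat.choose_pos (Nat.le_add_right i j)).ne').isUnit.map _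
    rcases hp.mem_or_mem ((p.unit_mul_mem_iff_mem hunit).mp hmain) with h | h
    · exact Nat.find_spec ha h
    · exact Nat.find_spec hb h

/-- If a ring over a field of characteristic zero has no proper nonzero ideal stable under a
derivation, then it is a domain. -/
theorem Derivation.isDomain_of_stable_eq_bot_or_top {k R : Type*} [Field k] [CharZero k]
    [CommRing R] [Nontrivial R] [Algebra k R] (τ : Derivation k R R)
    (h : ∀ J : Ideal R, (∀ r ∈ J, τ r ∈ J) → J = ⊥ ∨ J = ⊤) : IsDomain R := by
  obtain ⟨p, hp⟩ := Ideal.exists_maximal R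
  have hp' := hp.isPrime
  have hprime := τ.stableCore_isPrime p
  have hbot := (h (τ.stableCore p) fun r hr n => hr (n + 1)).resolve_right hprime.ne_top
  rw [hbot] at hprime
  exact IsDomain.of_bot_isPrime R

theorem Derivation.lie_smul_smul {k R : Type*} [CommRing k] [CommRing R] [Algebra k R]
    (τ : Derivation k R R) (f g : R) :
    ⁅f • τ, g • τ⁆ = (f * τ g - g * τ f) • τ := by
  ext x
  simp only [Derivation.commutator_apply, Derivation.smul_apply, Derivation.leibniz, smul_eq_mul]
  ring

/-- If the Lie algebra of derivations is simple and freely generated by `τ` as a module, then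
no proper nonzero ideal is stable under `τ`. -/
theorem Derivation.stable_eq_bot_or_top {k R : Type*} [CommRing k] [CommRing R] [Algebra k R]
    {τ : Derivation k R R} (hbij : Function.Bijective fun r : R => r • τ)
    (hsimple : LieAlgebra.IsSimple k (Derivation k R R))
    (J : Ideal R) (hJ : ∀ r ∈ J, τ r ∈ J) : J = ⊥ ∨ J = ⊤ := by
  let L : LieIdeal k (Derivation k R R) :=
    { (J.restrictScalars k).map ((LinearMap.toSpanSingleton R _ τ).restrictScalars k) with
      lie_mem := by
        rintro x _ ⟨f, hf, rfl⟩
        obtain ⟨g, rfl⟩ := hbij.2 x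
        exact ⟨g * τ f - f * τ g, J.sub_mem (J.mul_mem_left _ (hJ f hf)) (J.mul_mem_right _ hf),
          (τ.lie_smul_smul g f).symm⟩ }
  have hmem : ∀ f, f • τ ∈ L ↔ f ∈ J := fun f =>
    ⟨by
      rintro ⟨g, hg, hgf⟩
      exact hbij.1 hgf ▸ hg, fun hf => ⟨f, hf, rfl⟩⟩
  rcases hsimple.eq_bot_or_eq_top L with hL | hL
  · refine Or.inl ((Submodule.eq_bot_iff J).mpr fun f hf => hbij.1 ?_)
    have := (hmem f).mpr hf
    rw [hL, LieSubmodule.mem_bot] at this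
    simpa using this
  · refine Or.inr ((Ideal.eq_top_iff_one J).mpr ((hmem 1).mp ?_))
    rw [hL]
    exact LieSubmodule.mem_top _

theorem Derivation.span_range_eq_top {k R : Type*} [CommRing k] [CommRing R] [Algebra k R]
    {τ : Derivation k R R} (hτ : τ ≠ 0)
    (h : ∀ J : Ideal R, (∀ r ∈ J, τ r ∈ J) → J = ⊥ ∨ J = ⊤) :
    Ideal.span (Set.range τ) = ⊤ := by
  refine (h _ fun r _ => Ideal.subset_span (Set.mem_range_self r)).resolve_left fun hbot => hτ ?_
  ext r
  simpa using Ideal.span_eq_bot.mp hbot _ (Set.mem_range_self r)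

/-- Derivations extend along formally étale algebras. -/
theorem Derivation.exists_extension_of_formallyEtale {k P K : Type*} [CommRing k] [CommRing P]
    [CommRing K] [Algebra k P] [Algebra k K] [Algebra P K] [IsScalarTower k P K]
    [Algebra.FormallyEtale P K] (d : Derivation k P K) :
    ∃ D : Derivation k K K, ∀ p, D (algebraMap P K p) = d p := by
  let e := KaehlerDifferential.tensorKaehlerEquivOfFormallyEtale k P K
  let φ := d.liftKaehlerDifferential.liftBaseChange K ∘ₗ e.symm.toLinearMap
  refine ⟨φ.compDer (KaehlerDifferential.D k K), fun p => ?_⟩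
  simp [φ, e, KaehlerDifferential.tensorKaehlerEquivOfFormallyEtale_symm_D_algebraMap]

/-- A derivation from a finitely generated algebra to its fraction field becomes a derivation of
the algebra after multiplication by a common denominator. -/
theorem Derivation.exists_mul_eq_algebraMap {k R K : Type*} [CommRing k] [CommRing R] [IsDomain R]
    [Field K] [Algebra k R] [Algebra k K] [Algebra R K] [IsScalarTower k R K]
    [IsFractionRing R K] [Algebra.FiniteType k R] (D : Derivation k R K) :
    ∃ d : R, d ≠ 0 ∧ ∃ E : Derivation k R R, ∀ r,
      algebraMap R K (E r) = algebraMap R K d * D r := by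
  classical
  have hinj := IsFractionRing.injective R K
  obtain ⟨s, hs⟩ := Algebra.FiniteType.out (R := k) (A := R)
  obtain ⟨d, hd⟩ := IsLocalization.exist_integer_multiples_of_finset (nonZeroDivisors R) (s.image D)
  have hlift : ∀ r, ∃ t, algebraMap R K t = algebraMap R K d * D r := by
    intro r
    induction (hs ▸ Algebra.mem_top : r ∈ Algebra.adjoin k (s : Set R))
      using Algebra.adjoin_induction with
    | mem x hx =>
      obtain ⟨t, ht⟩ := hd _ (Finset.mem_image_of_mem D hx)
      exact ⟨t, by rw [ht, ← Algebra.smul_def]⟩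
    | algebraMap c => exact ⟨0, by simp⟩
    | add x y _ _ hx hy =>
      obtain ⟨⟨t, ht⟩, u, hu⟩ := And.intro hx hy
      exact ⟨t + u, by rw [map_add, map_add, ht, hu, mul_add]⟩
    | mul x y _ _ hx hy =>
      obtain ⟨⟨t, ht⟩, u, hu⟩ := And.intro hx hy
      refine ⟨x * u + y * t, ?_⟩
      rw [map_add, map_mul, map_mul, ht, hu, D.leibniz, Algebra.smul_def, Algebra.smul_def]
      ring
  choose E hE using hlift
  refine ⟨d, nonZeroDivisors.coe_ne_zero d, Derivation.mk'
    { toFun := E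
      map_add' := fun x y => hinj (by rw [map_add, hE, hE, hE, map_add, mul_add])
      map_smul' := fun c x => hinj (by
        rw [RingHom.id_apply, Algebra.smul_def c (E x), map_mul, hE, hE, D.map_smul,
          ← IsScalarTower.algebraMap_apply, Algebra.smul_def]
        ring) }
    fun x y => hinj ?_, hE⟩
  simp only [LinearMap.coe_mk, AddHom.coe_mk, smul_eq_mul, map_add, map_mul, hE, D.leibniz,
    Algebra.smul_def]
  ring

theorem MvPolynomial.dimensionLEOne_of_subsingleton {k σ : Type*} [Field k] [Finite σ]
    [Subsingleton σ] : Ring.DimensionLEOne (MvPolynomial σ k) where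
  maximalOfPrime := fun {p} hp hprime => by
    have : Ring.KrullDimLE 1 (MvPolynomial σ k) := by
      rw [Ring.krullDimLE_iff, MvPolynomial.ringKrullDim_of_isNoetherianRing,
        ringKrullDim_eq_zero_of_field, zero_add]
      exact_mod_cast Finite.card_le_one_iff_subsingleton.mpr inferInstance
    exact Ring.krullDimLE_one_iff_of_noZeroDivisors.mp this p hp hprime

/-- A finitely generated domain over a field of characteristic zero whose module of derivations
is cyclic has dimension at most one. -/
theorem Ring.dimensionLEOne_of_derivation_cyclic {k R : Type*} [Field k] [CharZero k] [CommRing R]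
    [IsDomain R] [Algebra k R] [Algebra.FiniteType k R] (τ : Derivation k R R)
    (hτ : Function.Surjective fun r : R => r • τ) : Ring.DimensionLEOne R := by
  obtain ⟨s, g, hg, hgint⟩ := exists_integral_inj_algHom_of_fg k R
  algebraize [g.toRingHom]
  have : IsScalarTower k (MvPolynomial (Fin s) k) R := .of_algebraMap_eq' g.comp_algebraMap.symm
  have : FaithfulSMul (MvPolynomial (Fin s) k) R := (faithfulSMul_iff_algebraMap_injective _ _).mpr hg
  let K := FractionRing R
  let F := FractionRing (MvPolynomial (Fin s) k)
  let := FractionRing.liftAlgebra (MvPolynomial (Fin s) k) K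
  have := FractionRing.isScalarTower_liftAlgebra (MvPolynomial (Fin s) k) K
  have : Algebra.IsAlgebraic F K :=
    (IsFractionRing.comap_isAlgebraic_iff (A := MvPolynomial (Fin s) k) (K := F) (C := K)).mp
      ((IsFractionRing.isAlgebraic_iff' (MvPolynomial (Fin s) k) R K).mp inferInstance)
  have : CharZero F := charZero_of_injective_algebraMap (algebraMap k F).injective
  have : Algebra.FormallyEtale F K := Algebra.FormallyEtale.of_isSeparable F K
  have : Algebra.FormallyEtale (MvPolynomial (Fin s) k) F :=
    .of_isLocalization (nonZeroDivisors (MvPolynomial (Fin s) k))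
  have : Algebra.FormallyEtale (MvPolynomial (Fin s) k) K := .comp _ F K
  have hE : ∀ i : Fin s, ∃ f : R, ∀ j, f * τ (g (.X j)) = 0 ↔ j ≠ i := by
    intro i
    obtain ⟨D, hD⟩ := Derivation.exists_extension_of_formallyEtale
      (MvPolynomial.mkDerivation k (Pi.single i 1 : Fin s → K))
    obtain ⟨d, hd, E, hE⟩ := (D.compAlgebraMap R).exists_mul_eq_algebraMap
    obtain ⟨f, rfl⟩ := hτ E
    refine ⟨f, fun j => ?_⟩
    have h := hE (g (.X j))
    have h' : D.compAlgebraMap R (g (.X j)) = (Pi.single i 1 : Fin s → K) j := by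
      rw [← MvPolynomial.mkDerivation_X k (Pi.single i 1 : Fin s → K) j, ← hD]
      rfl
    rw [h'] at h
    change algebraMap R K (f * τ (g (.X j))) = _ at h
    rw [← (IsFractionRing.injective R K).eq_iff' (map_zero _)]
    rw [h]
    by_cases hji : j = i <;> simp [hji, hd]
  have : Subsingleton (Fin s) := ⟨fun i j => by
    by_contra hij
    obtain ⟨a, ha⟩ := hE i
    obtain ⟨b, hb⟩ := hE j
    have hai := (ha i).not.mpr (by simp)
    have hbj := (hb j).not.mpr (by simp)
    have haj := (ha j).mpr (Ne.symm hij)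
    exact hbj (by rw [(mul_eq_zero.mp haj).resolve_left (left_ne_zero_of_mul hai), mul_zero])⟩
  have := MvPolynomial.dimensionLEOne_of_subsingleton (k := k) (σ := Fin s)
  exact .of_isIntegral (MvPolynomial (Fin s) k) R

/-- If the values of a derivation of a one-dimensional Noetherian domain over an infinite field
generate the unit ideal, then two of them already do. -/
theorem Derivation.exists_isCoprime {k R : Type*} [Field k] [Infinite k] [CommRing R] [IsDomain R]
    [IsNoetherianRing R] [Ring.DimensionLEOne R] [Algebra k R] (τ : Derivation k R R)
    (hspan : Ideal.span (Set.range τ) = ⊤) : ∃ v w : R, IsCoprime (τ v) (τ w) := by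
  classical
  obtain ⟨v, hv⟩ : ∃ v, τ v ≠ 0 := by
    by_contra! h
    refine bot_ne_top (α := Ideal R) (hspan ▸ (Ideal.span_eq_bot.mpr ?_).symm)
    rintro _ ⟨r, rfl⟩
    exact h r
  have hfin := (Ideal.span {τ v}).finite_minimalPrimes_of_isNoetherianRing R
  let V : Ideal R → Submodule k R := fun p => (p.restrictScalars k).comap (τ : R →ₗ[k] R)
  have hV : ⊤ ∉ hfin.toFinset.image V := by
    intro htop
    obtain ⟨p, hp, hpV⟩ := Finset.mem_image.mp htop
    refine ((hfin.mem_toFinset.mp hp).1.1).ne_top (top_le_iff.mp (hspan ▸ Ideal.span_le.mpr ?_))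
    rintro _ ⟨r, rfl⟩
    exact (hpV ▸ Submodule.mem_top : r ∈ V p)
  obtain ⟨w, hw⟩ := (Set.ne_univ_iff_exists_notMem _).mp (Subspace.biUnion_ne_univ_of_top_notMem hV)
  refine ⟨v, w, Ideal.isCoprime_span_singleton_iff _ _ |>.mp (Ideal.isCoprime_iff_sup_eq.mpr ?_)⟩
  by_contra hne
  obtain ⟨m, hm, hle⟩ := Ideal.exists_le_maximal _ hne
  have := hm.isPrime
  obtain ⟨p, hp, hpm⟩ := Ideal.exists_minimalPrimes_le (le_sup_left.trans hle)
  have hp0 : p ≠ ⊥ := fun h => hv (by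
    simpa [h] using hp.1.2 (Ideal.mem_span_singleton_self (τ v)))
  have hpm : p = m := (hp.1.1.isMaximal hp0).eq_of_le hm.ne_top hpm
  refine hw (Set.mem_biUnion (Finset.mem_image_of_mem V (hfin.mem_toFinset.mpr hp)) ?_)
  exact (hpm ▸ hle (Ideal.mem_sup_right (Ideal.mem_span_singleton_self (τ w))) : τ w ∈ p)

theorem Derivation.exists_eq_lie_add_lie_add_lie {k R : Type*} [Field k] [CharZero k] [CommRing R]
    [Algebra k R] {τ : Derivation k R R} {v w : R} (h : IsCoprime (τ v) (τ w)) (r : R) :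
    ∃ D₁ D₂ D₃ D₄ D₅ D₆ : Derivation k R R, r • τ = ⁅D₁, D₂⁆ + ⁅D₃, D₄⁆ + ⁅D₅, D₆⁆ := by
  obtain ⟨a, b, hab⟩ := h
  let c := algebraMap k R 2⁻¹
  have hc : c * 2 = 1 := by
    rw [← map_ofNat (algebraMap k R) 2, ← map_mul, inv_mul_cancel₀ two_ne_zero, map_one]
  have hτc : τ c = 0 := τ.map_algebraMap _
  refine ⟨(c * r * a) • τ, v • τ, (c * r * b) • τ, w • τ,
    (1 : R) • τ, (c * r * a * v + c * r * b * w) • τ, ?_⟩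
  simp only [Derivation.lie_smul_smul, ← add_smul]
  congr 1
  simp only [map_add, Derivation.leibniz, smul_eq_mul, hτc, Derivation.map_one_eq_zero]
  linear_combination (-r) * hab - r * (a * τ v + b * τ w) * hc

/-- The bracket width of the Lie algebra of derivations of a finitely generated algebra over a
field of characteristic zero is at most three if it is simple and free of rank one. -/
theorem Derivation.exists_eq_lie_add_lie_add_lie_of_isSimple {k R : Type*} [Field k] [CharZero k]
    [CommRing R] [Algebra k R] [Algebra.FiniteType k R] {τ : Derivation k R R}
    (hbij : Function.Bijective fun r : R => r • τ)
    (hsimple : LieAlgebra.IsSimple k (Derivation k R R)) (D : Derivation k R R) :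
    ∃ D₁ D₂ D₃ D₄ D₅ D₆ : Derivation k R R, D = ⁅D₁, D₂⁆ + ⁅D₃, D₄⁆ + ⁅D₅, D₆⁆ := by
  have hτ : τ ≠ 0 := by
    rintro rfl
    refine hsimple.non_abelian ⟨fun x y => ?_⟩
    obtain ⟨f, rfl⟩ := hbij.2 x
    simp
  have : Nontrivial R := by
    by_contra h
    rw [not_nontrivial_iff_subsingleton] at h
    exact hτ (Derivation.ext fun _ => Subsingleton.elim _ _)
  have hstable := Derivation.stable_eq_bot_or_top hbij hsimple
  have := τ.isDomain_of_stable_eq_bot_or_top hstable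
  have := Ring.dimensionLEOne_of_derivation_cyclic τ hbij.2
  have := Algebra.FiniteType.isNoetherianRing k R
  have := Infinite.of_injective _ (Nat.cast_injective (R := k))
  obtain ⟨v, w, hvw⟩ := τ.exists_isCoprime (Derivation.span_range_eq_top hτ hstable)
  obtain ⟨r, rfl⟩ := hbij.2 D
  exact Derivation.exists_eq_lie_add_lie_add_lie hvw r

/-- Theorem A (first part): if `C` is a smooth affine curve in `𝔸³` with trivial
tangent sheaf trivialized by `τ`, and `Der_k(R)` is simple, then every derivation is
a sum of three Lie brackets. -/
theorem stmt_0 (k : Type*) [Field k] [CharZero k]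
    (I : Ideal (MvPolynomial (Fin 3) k))
    (τ' : Derivation k (MvPolynomial (Fin 3) k) (MvPolynomial (Fin 3) k))
    (hτ' : ∀ a ∈ I, τ' a ∈ I)
    (τ : Derivation k (MvPolynomial (Fin 3) k ⧸ I) (MvPolynomial (Fin 3) k ⧸ I))
    (hτ : ∀ a : MvPolynomial (Fin 3) k,
      τ (Ideal.Quotient.mk I a) = Ideal.Quotient.mk I (τ' a))
    (hbij : Function.Bijective
      (fun r : MvPolynomial (Fin 3) k ⧸ I => r • τ))
    (hsimple : LieAlgebra.IsSimple k
      (Derivation k (MvPolynomial (Fin 3) k ⧸ I) (MvPolynomial (Fin 3) k ⧸ I)))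
    (D : Derivation k (MvPolynomial (Fin 3) k ⧸ I) (MvPolynomial (Fin 3) k ⧸ I)) :
    ∃ D₁ D₂ D₃ D₄ D₅ D₆ :
        Derivation k (MvPolynomial (Fin 3) k ⧸ I) (MvPolynomial (Fin 3) k ⧸ I),
      D = ⁅D₁, D₂⁆ + ⁅D₃, D₄⁆ + ⁅D₅, D₆⁆ := by
  exact Derivation.exists_eq_lie_add_lie_add_lie_of_isSimple hbij hsimple D
end

section
/- Let k be a field of characteristic zero, A = k[X₀,X₁] the polynomial ring in two variables over k, I ⊆ A an ideal, R = A/I, and π : A → R the quotient map. Suppose τ̃ is a k-derivation of A with τ̃(I) ⊆ I, and let τ be the induced k-derivation of R (i.e. τ(π(a)) = π(τ̃(a)) for all a ∈ A). Assume that the map R → Der_k(R), r ↦ r·τ, is bijective, and that Der_k(R) is a simple Lie algebra over k. Then every D ∈ Der_k(R) can be written as a sum of two Lie brackets: there exist D₁, D₂, D₃, D₄ ∈ Der_k(R) with D = ⁅D₁,D₂⁆ + ⁅D₃,D₄⁆. -/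
set_option synthInstance.maxHeartbeats 1000000
set_option maxHeartbeats 2000000

open MvPolynomial in
theorem MvPolynomial.pderiv_surjective {k σ : Type*} [Field k] [CharZero k] (i : σ) :
    Function.Surjective (pderiv i : MvPolynomial σ k → MvPolynomial σ k) := by
  intro q
  induction q using MvPolynomial.induction_on' with
  | monomial m c =>
    refine ⟨monomial (m + Finsupp.single i 1) (c / ((m i : k) + 1)), ?_⟩
    have h : (m i : k) + 1 ≠ 0 := Nat.cast_add_one_ne_zero _
    simp [pderiv_monomial, div_mul_cancel₀ _ h]
  | add p q hp hq =>
    obtain ⟨P, rfl⟩ := hp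
    obtain ⟨Q, rfl⟩ := hq
    exact ⟨P + Q, map_add _ _ _⟩

open MvPolynomial in
theorem MvPolynomial.derivation_fin_two_apply {k : Type*} [CommRing k]
    (d : Derivation k (MvPolynomial (Fin 2) k) (MvPolynomial (Fin 2) k))
    (a : MvPolynomial (Fin 2) k) :
    d a = pderiv 0 a * d (X 0) + pderiv 1 a * d (X 1) := by
  have h : d = d (X 0) • pderiv 0 + d (X 1) • pderiv 1 := by
    refine MvPolynomial.derivation_ext fun i => ?_
    fin_cases i <;> simp [pderiv_X]
  conv_lhs => rw [h]
  simp [mul_comm]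

theorem Derivation.smul_eq_lie_add_lie {k R : Type*} [CommRing k] [CommRing R] [Algebra k R]
    (τ : Derivation k R R) (u g x : R) :
    (τ u + (g + g) * τ x) • τ = ⁅(1 : R) • τ, (u + g * x) • τ⁆ + ⁅g • τ, x • τ⁆ := by
  rw [Derivation.lie_smul_smul, Derivation.lie_smul_smul, ← add_smul]
  congr 1
  simp only [map_add, Derivation.leibniz, smul_eq_mul, Derivation.map_one_eq_zero]
  ring

/-- If `τ` freely generates a simple Lie algebra of derivations, then any ideal containing the
image of `τ` is the whole ring. -/
theorem Ideal.eq_top_of_isSimple_derivation {k R : Type*} [CommRing k] [CommRing R] [Algebra k R]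
    (τ : Derivation k R R) (hbij : Function.Bijective (fun r : R => r • τ))
    (hsimple : LieAlgebra.IsSimple k (Derivation k R R))
    (J : Ideal R) (hJ : ∀ a, τ a ∈ J) : J = ⊤ := by
  let L : LieIdeal k (Derivation k R R) :=
    { carrier := {D | ∃ r ∈ J, r • τ = D}
      add_mem' := by
        rintro _ _ ⟨r, hr, rfl⟩ ⟨s, hs, rfl⟩
        exact ⟨r + s, J.add_mem hr hs, add_smul _ _ _⟩
      zero_mem' := ⟨0, J.zero_mem, zero_smul _ _⟩
      smul_mem' := by
        rintro c _ ⟨r, hr, rfl⟩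
        exact ⟨c • r, J.smul_of_tower_mem c hr, smul_assoc _ _ _⟩
      lie_mem := by
        rintro E _ ⟨r, hr, rfl⟩
        obtain ⟨s, rfl⟩ := hbij.2 E
        exact ⟨s * τ r - r * τ s, J.sub_mem (J.mul_mem_left _ (hJ r)) (J.mul_mem_right _ hr),
          (Derivation.lie_smul_smul τ s r).symm⟩ }
  have hL : ∀ r, r • τ ∈ L → r ∈ J := by
    rintro r ⟨s, hs, h⟩
    exact hbij.1 h ▸ hs
  rcases hsimple.eq_bot_or_eq_top L with h | h
  · refine absurd ⟨fun D E => ?_⟩ hsimple.non_abelian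
    obtain ⟨f, rfl⟩ := hbij.2 D
    obtain ⟨g, rfl⟩ := hbij.2 E
    have hmem : (f * τ g - g * τ f) • τ ∈ L :=
      ⟨_, J.sub_mem (J.mul_mem_left _ (hJ g)) (J.mul_mem_left _ (hJ f)), rfl⟩
    rw [h, LieSubmodule.mem_bot] at hmem
    exact (Derivation.lie_smul_smul τ f g).trans hmem
  · exact (Ideal.eq_top_iff_one J).2 (hL 1 (h ▸ LieSubmodule.mem_top _))

/-- Theorem A (second part): the plane-curve case, bracket width at most two. -/
theorem stmt_2 (k : Type*) [Field k] [CharZero k]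
    (I : Ideal (MvPolynomial (Fin 2) k))
    (τ' : Derivation k (MvPolynomial (Fin 2) k) (MvPolynomial (Fin 2) k))
    (hτ' : ∀ a ∈ I, τ' a ∈ I)
    (τ : Derivation k (MvPolynomial (Fin 2) k ⧸ I) (MvPolynomial (Fin 2) k ⧸ I))
    (hτ : ∀ a : MvPolynomial (Fin 2) k,
      τ (Ideal.Quotient.mk I a) = Ideal.Quotient.mk I (τ' a))
    (hbij : Function.Bijective
      (fun r : MvPolynomial (Fin 2) k ⧸ I => r • τ))
    (hsimple : LieAlgebra.IsSimple k
      (Derivation k (MvPolynomial (Fin 2) k ⧸ I) (MvPolynomial (Fin 2) k ⧸ I)))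
    (D : Derivation k (MvPolynomial (Fin 2) k ⧸ I) (MvPolynomial (Fin 2) k ⧸ I)) :
    ∃ D₁ D₂ D₃ D₄ :
        Derivation k (MvPolynomial (Fin 2) k ⧸ I) (MvPolynomial (Fin 2) k ⧸ I),
      D = ⁅D₁, D₂⁆ + ⁅D₃, D₄⁆ := by
  obtain ⟨h, rfl⟩ := hbij.2 D
  have htop : Ideal.span {τ (Ideal.Quotient.mk I (MvPolynomial.X 0)),
      τ (Ideal.Quotient.mk I (MvPolynomial.X 1))} = ⊤ := by
    refine Ideal.eq_top_of_isSimple_derivation τ hbij hsimple _ fun a => ?_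
    obtain ⟨a, rfl⟩ := Ideal.Quotient.mk_surjective a
    rw [hτ a, MvPolynomial.derivation_fin_two_apply τ' a, map_add, map_mul, map_mul, ← hτ, ← hτ]
    exact Ideal.mem_span_pair.2 ⟨_, _, rfl⟩
  obtain ⟨p, q, hpq⟩ := Ideal.mem_span_pair.1 (htop ▸ Submodule.mem_top (x := h))
  obtain ⟨p, rfl⟩ := Ideal.Quotient.mk_surjective p
  obtain ⟨q, rfl⟩ := Ideal.Quotient.mk_surjective q
  obtain ⟨Q, rfl⟩ := MvPolynomial.pderiv_surjective 1 q
  have hQ := hτ Q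
  rw [MvPolynomial.derivation_fin_two_apply τ' Q, map_add, map_mul, map_mul, ← hτ, ← hτ] at hQ
  obtain ⟨g, hg⟩ : ∃ g, g + g = Ideal.Quotient.mk I (p - MvPolynomial.pderiv 0 Q) := by
    refine ⟨Ideal.Quotient.mk I (MvPolynomial.C (1 / 2) * (p - MvPolynomial.pderiv 0 Q)), ?_⟩
    rw [← map_add, ← add_mul, ← map_add, add_halves, map_one, one_mul]
  rw [map_sub] at hg
  generalize Ideal.Quotient.mk I (MvPolynomial.X 0) = x at *
  refine ⟨(1 : MvPolynomial (Fin 2) k ⧸ I) • τ, (Ideal.Quotient.mk I Q + g * x) • τ,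
    g • τ, x • τ, ?_⟩
  refine Eq.trans ?_ (Derivation.smul_eq_lie_add_lie τ (Ideal.Quotient.mk I Q) g x)
  change h • τ = _
  congr 1
  linear_combination -hpq - hQ - τ x * hg
end

section
/- Let k be a field of characteristic zero, f ∈ k[X] a nonzero polynomial, and S the localization of the polynomial ring k[X] away from f (i.e. S = k[X][1/f]). Then every k-derivation D of S is a single Lie bracket: there exist k-derivations D₁, D₂ of S with D = ⁅D₁, D₂⁆. -/
set_option synthInstance.maxHeartbeats 1000000
set_option maxHeartbeats 2000000

open Polynomial in
/-- Over a field of characteristic zero every polynomial has an antiderivative. -/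
theorem Polynomial.derivative_surjective_of_charZero (k : Type*) [Field k] [CharZero k] :
    Function.Surjective (derivative : k[X] →ₗ[k] k[X]) := by
  intro p
  induction p using Polynomial.induction_on' with
  | add p q hp hq =>
    obtain ⟨P, rfl⟩ := hp
    obtain ⟨Q, rfl⟩ := hq
    exact ⟨P + Q, map_add _ _ _⟩
  | monomial n a =>
    refine ⟨monomial (n + 1) (a / (n + 1 : k)), ?_⟩
    have h : (n + 1 : k) ≠ 0 := Nat.cast_add_one_ne_zero n
    rw [derivative_monomial]
    simp [h]

/-- A derivation into a module over a localization extends to that localization. -/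
theorem Derivation.exists_extension_of_isLocalization {k A S : Type*} [CommRing k] [CommRing A]
    [CommRing S] [Algebra k A] [Algebra A S] [Algebra k S] [IsScalarTower k A S]
    (M : Submonoid A) [IsLocalization M S] (d : Derivation k A S) :
    ∃ D : Derivation k S S, ∀ a, D (algebraMap A S a) = d a := by
  have : Algebra.FormallyEtale A S := Algebra.FormallyEtale.of_isLocalization M
  have hb := KaehlerDifferential.isBaseChange_of_formallyEtale k A S
  refine ⟨(hb.lift d.liftKaehlerDifferential).compDer (KaehlerDifferential.D k S), fun a => ?_⟩
  have h := hb.lift_eq d.liftKaehlerDifferential (KaehlerDifferential.D k A a)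
  simpa using h

/-- Derivations of a localization are determined by their values on the base ring. -/
theorem Derivation.ext_of_isLocalization {k A S : Type*} [CommRing k] [CommRing A]
    [CommRing S] [Algebra k A] [Algebra A S] [Algebra k S]
    (M : Submonoid A) [IsLocalization M S] {D E : Derivation k S S}
    (h : ∀ a, D (algebraMap A S a) = E (algebraMap A S a)) : D = E := by
  ext s
  obtain ⟨⟨p, m⟩, hs⟩ := IsLocalization.surj M s
  have hD := congrArg D hs
  have hE := congrArg E hs
  simp only [Derivation.leibniz, smul_eq_mul, h] at hD hE
  refine (IsLocalization.map_units S m).mul_left_cancel ?_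
  linear_combination hD - hE

/-- Corollary 2: every derivation of `k[X][1/f]` is a single Lie bracket. -/
theorem stmt_6 (k : Type*) [Field k] [CharZero k]
    (f : Polynomial k) (hf : f ≠ 0)
    (S : Type*) [CommRing S] [Algebra (Polynomial k) S] [IsLocalization.Away f S]
    [Algebra k S] [IsScalarTower k (Polynomial k) S]
    (D : Derivation k S S) :
    ∃ D₁ D₂ : Derivation k S S, D = ⁅D₁, D₂⁆ := by
  obtain ⟨d, hd⟩ := Derivation.exists_extension_of_isLocalization (Submonoid.powers f)
    (Polynomial.mkDerivation k (1 : S))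
  obtain ⟨⟨p, m⟩, hp⟩ := IsLocalization.surj (Submonoid.powers f)
    (D (algebraMap (Polynomial k) S Polynomial.X))
  obtain ⟨G, hG⟩ := Polynomial.derivative_surjective_of_charZero k (p * m)
  obtain ⟨a, ha⟩ := (IsLocalization.map_units S m).exists_left_inv
  have hdX : d (algebraMap (Polynomial k) S Polynomial.X) = 1 := by rw [hd, Polynomial.mkDerivation_X]
  have hdG : d (algebraMap (Polynomial k) S G) = algebraMap (Polynomial k) S p * algebraMap (Polynomial k) S (m : Polynomial k) := by
    rw [hd, Polynomial.mkDerivation_apply, hG, Algebra.smul_def, mul_one, map_mul]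
  refine ⟨a • d, (a * algebraMap (Polynomial k) S G) • d, ?_⟩
  apply Derivation.ext_of_isLocalization (Submonoid.powers f)
  refine fun q => DFunLike.congr_fun (Polynomial.derivation_ext
    (D₁ := D.compAlgebraMap (Polynomial k))
    (D₂ := Derivation.compAlgebraMap (Polynomial k) ⁅a • d, (a * algebraMap (Polynomial k) S G) • d⁆) ?_) q
  change D (algebraMap (Polynomial k) S Polynomial.X) =
    ⁅a • d, (a * algebraMap (Polynomial k) S G) • d⁆ (algebraMap (Polynomial k) S Polynomial.X)
  simp only [Derivation.commutator_apply, Derivation.smul_apply, smul_eq_mul, hdX, mul_one,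
    Derivation.leibniz, hdG]
  dsimp only at hp
  generalize algebraMap (Polynomial k) S (m : Polynomial k) = u at *
  generalize algebraMap (Polynomial k) S p = v at *
  generalize D (algebraMap (Polynomial k) S Polynomial.X) = c at *
  subst hp
  linear_combination (-c * (a * u + 1)) * ha
end
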